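/- There is no unitary operator V on ℂ²⊗ℂ² such that (I ⊗ V ⊗ I)(|Φ+⟩_{1,2} ⊗ |Φ+⟩_{3,4}) = |W₄⟩, where the operator acts as the identity on qubits 1 and 4 and as V on qubits 2 and 3. -/

import Mathlib

open scoped BigOperators

/-- Two Bell pairs `|Φ+⟩₁₂ ⊗ |Φ+⟩₃₄` as four-qubit amplitudes; basis: `0 = |H⟩`, `1 = |V⟩`.
Component at `(a,b,c,d)` is `(1/2)·[a = b]·[c = d]`. -/
noncomputable def bellPairs : Fin 2 × Fin 2 × Fin 2 × Fin 2 → ℂ :=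
  fun x => (if x.1 = x.2.1 then 1 else 0) * (if x.2.2.1 = x.2.2.2 then 1 else 0) / 2

/-- Apply a two-qubit operator `V` (a `4 × 4` matrix) to qubits 2 and 3 of a four-qubit
state, acting as the identity on qubits 1 and 4: this is `I ⊗ V ⊗ I`. -/
noncomputable def applyMid (V : Matrix (Fin 2 × Fin 2) (Fin 2 × Fin 2) ℂ)
    (f : Fin 2 × Fin 2 × Fin 2 × Fin 2 → ℂ) : Fin 2 × Fin 2 × Fin 2 × Fin 2 → ℂ :=
  fun x => ∑ b : Fin 2, ∑ c : Fin 2, V (x.2.1, x.2.2.1) (b, c) * f (x.1, b, c, x.2.2.2)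

/-- The four-qubit W state `|W₄⟩ = (|HHHV⟩+|HHVH⟩+|HVHH⟩+|VHHH⟩)/2`. -/
noncomputable def w4 : Fin 2 × Fin 2 × Fin 2 × Fin 2 → ℂ :=
  fun x => ((if x = (0, 0, 0, 1) then 1 else 0) + (if x = (0, 0, 1, 0) then 1 else 0)
    + (if x = (0, 1, 0, 0) then 1 else 0) + (if x = (1, 0, 0, 0) then 1 else 0)) / 2

theorem applyMid_bellPairs (V : Matrix (Fin 2 × Fin 2) (Fin 2 × Fin 2) ℂ) (a b c d : Fin 2) :
    applyMid V bellPairs (a, b, c, d) = V (b, c) (a, d) / 2 := by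
  simp [applyMid, bellPairs, div_eq_mul_inv]

theorem w4_one_one (b c : Fin 2) : w4 (1, b, c, 1) = 0 := by
  simp [w4]

/-- There is no unitary `V` on `ℂ²⊗ℂ²` with `(I ⊗ V ⊗ I)(|Φ+⟩₁₂ ⊗ |Φ+⟩₃₄) = |W₄⟩`. -/
theorem bell_pairs_not_to_w4 :
    ¬ ∃ V ∈ Matrix.unitaryGroup (Fin 2 × Fin 2) ℂ, applyMid V bellPairs = w4 := by
  rintro ⟨V, hV, h⟩
  have hcol (p : Fin 2 × Fin 2) : V p (1, 1) = 0 := by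
    have hp := congrFun h (1, p.1, p.2, 1)
    rw [applyMid_bellPairs, w4_one_one] at hp
    simpa using hp
  have hdiag := congrFun₂ (Matrix.mem_unitaryGroup_iff'.mp hV) (1, 1) (1, 1)
  simp [Matrix.mul_apply, hcol] at hdiag
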